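/- There exists a universal constant K ≥ 32 such that the following holds: for every integer k ≥ 2, every prime p > k^{K·k}, every integer n ≥ 1, every nonsingular n×n matrix M over F_p, and all subsets X_1,…,X_n, Y_1,…,Y_n ⊆ F_p each of size at least p − k, there exists a vector x ∈ F_p^n with x_i ∈ X_i for every 1 ≤ i ≤ n and (Mx)_i ∈ Y_i for every 1 ≤ i ≤ n. -/

import Mathlib

open Finset

/-- A set `T` of nonzero residues is universal if, for every nonzero frequency `β` and every
`v ∈ T ∪ {0}`, some nonnegative combination of the numbers `ψ (t * β)` with `t ∈ T ∪ {v}`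
in which `v` has positive weight vanishes; here `ψ` is the standard additive character. -/
def IsUniversal {p : ℕ} [NeZero p] (T : Finset (ZMod p)) : Prop :=
  0 ∉ T ∧ ∀ β : ZMod p, β ≠ 0 → ∀ v, v = 0 ∨ v ∈ T →
    ∃ c : ZMod p → ℝ, (∀ t, 0 ≤ c t) ∧ 0 < c v ∧ (∀ t, c t ≠ 0 → t = v ∨ t ∈ T) ∧
      ∑ t, (c t : ℂ) * ZMod.stdAddChar (t * β) = 0

lemma IsUniversal.image_mul {p : ℕ} [Fact p.Prime] {T : Finset (ZMod p)} (hT : IsUniversal T)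
    {r : ZMod p} (hr : r ≠ 0) : IsUniversal (T.image (r * ·)) := by
  refine ⟨by simpa [hr] using hT.1, fun β hβ v hv => ?_⟩
  obtain ⟨c, h0, h1, h2, h3⟩ := hT.2 (r * β) (mul_ne_zero hr hβ) (r⁻¹ * v) (by
    rcases hv with rfl | hv
    · simp
    · obtain ⟨t, ht, rfl⟩ := mem_image.1 hv
      right; simpa [hr] using ht)
  refine ⟨fun t => c (r⁻¹ * t), fun t => h0 _, h1, fun t ht => ?_, ?_⟩
  · rcases h2 _ ht with h | h
    · left; exact mul_left_cancel₀ (inv_ne_zero hr) h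
    · right; exact mem_image.2 ⟨_, h, by simp [hr]⟩
  · rw [← h3]
    refine Fintype.sum_equiv (Equiv.mulLeft₀ r⁻¹ (inv_ne_zero hr)) _ _ fun t => ?_
    simp only [Equiv.mulLeft₀_apply]
    congr 2
    field_simp

lemma two_pow_mul_one_sub_cos_le {θ : ℝ} {l : ℕ} (h : ∀ j ≤ l, 0 ≤ Real.cos (2 ^ j * θ)) :
    ∀ j ≤ l, 2 ^ j * (1 - Real.cos θ) ≤ 1 - Real.cos (2 ^ j * θ) := by
  intro j
  induction j with
  | zero => simp
  | succ j ih =>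
    intro hj
    have h1 := ih (by omega)
    have h2 := h j (by omega)
    have h3 : Real.cos (2 ^ (j + 1) * θ) = 2 * Real.cos (2 ^ j * θ) ^ 2 - 1 := by
      rw [← Real.cos_two_mul]; ring_nf
    rw [h3, pow_succ]
    nlinarith [Real.cos_le_one (2 ^ j * θ)]

lemma exists_cos_pos (θ : ℝ) :
    ∃ m ∈ ({1, 2, 3, 4} : Finset ℕ), 0 < Real.cos (m * θ) := by
  by_contra! h
  have h1 := h 1 (by simp)
  have h2 := h 2 (by simp)
  have h3 := h 3 (by simp)
  have h4 := h 4 (by simp)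
  push_cast at h1 h2 h3 h4
  rw [one_mul] at h1
  rw [Real.cos_two_mul] at h2
  rw [Real.cos_three_mul] at h3
  rw [show (4 : ℝ) * θ = 2 * (2 * θ) by ring, Real.cos_two_mul, Real.cos_two_mul] at h4
  set c := Real.cos θ
  have : c = 0 := by
    by_contra hc
    have : c < 0 := lt_of_le_of_ne h1 hc
    nlinarith
  rw [this] at h4
  norm_num at h4

section Dyadic

variable {p : ℕ}

lemma re_stdAddChar_natCast_mul [Fact p.Prime] (m : ℕ) (β : ZMod p) :
    (ZMod.stdAddChar ((m : ZMod p) * β) : ℂ).re =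
      Real.cos (m * (2 * Real.pi * β.valMinAbs / p)) := by
  have : (m : ZMod p) * β = ((m * β.valMinAbs : ℤ) : ZMod p) := by
    rw [Int.cast_mul, ZMod.coe_valMinAbs, Int.cast_natCast]
  rw [this, ZMod.stdAddChar_coe, ← Complex.exp_ofReal_mul_I_re]
  congr 2
  push_cast
  ring

lemma stdAddChar_add_neg [Fact p.Prime] (x : ZMod p) :
    (ZMod.stdAddChar x : ℂ) + ZMod.stdAddChar (-x) =
      ((2 * (ZMod.stdAddChar x : ℂ).re : ℝ) : ℂ) := by
  rw [AddChar.map_neg_eq_conj, Complex.add_conj]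

lemma exists_re_stdAddChar_neg [Fact p.Prime] {β : ZMod p} (hβ : β ≠ 0) {l : ℕ}
    (hl : p ^ 2 ≤ 2 ^ l) :
    ∃ j ≤ l, (ZMod.stdAddChar (((2 ^ j : ℕ) : ZMod p) * β) : ℂ).re < 0 := by
  by_contra! h
  simp only [re_stdAddChar_natCast_mul] at h
  set θ : ℝ := 2 * Real.pi * β.valMinAbs / p with hθ
  push_cast at h
  have h1 := two_pow_mul_one_sub_cos_le h l le_rfl
  have h2 := h l le_rfl
  have hp : (0 : ℝ) < p := by exact_mod_cast (Fact.out : p.Prime).pos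
  have hv : (1 : ℝ) ≤ (β.valMinAbs : ℝ) ^ 2 := by
    have : β.valMinAbs ≠ 0 := by simpa using hβ
    have : 1 ≤ β.valMinAbs ^ 2 := by have := sq_pos_of_ne_zero this; omega
    exact_mod_cast this
  have habs : |θ| ≤ Real.pi := by
    have h5 : 2 * |(β.valMinAbs : ℝ)| ≤ p := by
      have := ZMod.natAbs_valMinAbs_le β
      have h6 : 2 * β.valMinAbs.natAbs ≤ p := by omega
      have h7 : ((β.valMinAbs.natAbs : ℕ) : ℝ) = |(β.valMinAbs : ℝ)| := by
        simp [Nat.cast_natAbs]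
      rw [← h7]; exact_mod_cast h6
    rw [hθ, abs_div, abs_mul, abs_of_pos hp, abs_of_pos Real.two_pi_pos, div_le_iff₀ hp]
    nlinarith [Real.pi_pos]
  have h3 := Real.cos_le_one_sub_mul_cos_sq habs
  have h4 : 8 / (p : ℝ) ^ 2 ≤ 2 / Real.pi ^ 2 * θ ^ 2 := by
    have : 2 / Real.pi ^ 2 * θ ^ 2 = 8 / (p : ℝ) ^ 2 * (β.valMinAbs : ℝ) ^ 2 := by
      rw [hθ]; field_simp [Real.pi_ne_zero]; ring
    rw [this]
    exact le_mul_of_one_le_right (by positivity) hv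
  have h8 : (1 : ℝ) ≤ 2 ^ l / (p : ℝ) ^ 2 := by
    rw [one_le_div (by positivity)]; exact_mod_cast hl
  have h9 : (2 : ℝ) ^ l * (8 / (p : ℝ) ^ 2) ≤ 2 ^ l * (1 - Real.cos θ) := by
    gcongr; linarith
  have h10 : (2 : ℝ) ^ l * (8 / (p : ℝ) ^ 2) = 8 * (2 ^ l / (p : ℝ) ^ 2) := by ring
  linarith

/-- The residues `±3` and `±2 ^ j` for `j ≤ l`. -/
def dyadicSet (p l : ℕ) : Finset (ZMod p) :=
  (insert 3 ((range (l + 1)).image fun j => ((2 ^ j : ℕ) : ZMod p))) ∪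
    (insert 3 ((range (l + 1)).image fun j => ((2 ^ j : ℕ) : ZMod p))).image (- ·)

lemma card_dyadicSet_le (l : ℕ) : (dyadicSet p l).card ≤ 2 * (l + 2) := by
  have h : (insert 3 ((range (l + 1)).image fun j => ((2 ^ j : ℕ) : ZMod p))).card ≤ l + 2 :=
    (card_insert_le _ _).trans (by simpa using card_image_le (s := range (l + 1)))
  exact (card_union_le _ _).trans (by
    have := (card_image_le (f := (- ·))).trans h
    omega)

lemma neg_mem_dyadicSet {l : ℕ} {t : ZMod p} (ht : t ∈ dyadicSet p l) : -t ∈ dyadicSet p l := by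
  simp only [dyadicSet, mem_union, mem_image] at ht ⊢
  rcases ht with h | ⟨s, hs, rfl⟩
  · exact Or.inr ⟨t, h, rfl⟩
  · left; simpa using hs

lemma two_pow_mem_dyadicSet {l j : ℕ} (hj : j ≤ l) : ((2 ^ j : ℕ) : ZMod p) ∈ dyadicSet p l :=
  mem_union_left _ (mem_insert_of_mem (mem_image_of_mem _ (mem_range.2 (by omega))))

lemma zero_notMem_dyadicSet [Fact p.Prime] (hp : 3 < p) (l : ℕ) : (0 : ZMod p) ∉ dyadicSet p l := by
  have h2 : (2 : ZMod p) ≠ 0 := by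
    intro h
    have := (ZMod.natCast_eq_zero_iff 2 p).1 (by exact_mod_cast h)
    have := Nat.le_of_dvd (by norm_num) this
    omega
  have h3 : (3 : ZMod p) ≠ 0 := by
    intro h
    have := (ZMod.natCast_eq_zero_iff 3 p).1 (by exact_mod_cast h)
    have := Nat.le_of_dvd (by norm_num) this
    omega
  simp [dyadicSet, h2, h3, h3.symm]

lemma exists_re_stdAddChar_pos [Fact p.Prime] (β : ZMod p) {l : ℕ} (hl : 2 ≤ l) :
    ∃ t ∈ dyadicSet p l, 0 < (ZMod.stdAddChar (t * β) : ℂ).re := by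
  obtain ⟨m, hm, h⟩ := exists_cos_pos (2 * Real.pi * β.valMinAbs / p)
  rw [← re_stdAddChar_natCast_mul] at h
  refine ⟨m, ?_, h⟩
  simp only [mem_insert, mem_singleton] at hm
  rcases hm with rfl | rfl | rfl | rfl
  · exact two_pow_mem_dyadicSet (p := p) (l := l) (j := 0) (by omega)
  · exact two_pow_mem_dyadicSet (p := p) (l := l) (j := 1) (by omega)
  · simp [dyadicSet]
  · exact two_pow_mem_dyadicSet (p := p) (l := l) (j := 2) (by omega)

lemma isUniversal_dyadicSet [Fact p.Prime] (hp : 3 < p) {l : ℕ} (hl : 2 ≤ l)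
    (hpl : p ^ 2 ≤ 2 ^ l) :
    IsUniversal (dyadicSet p l) := by
  refine ⟨zero_notMem_dyadicSet hp l, fun β hβ v hv => ?_⟩
  have key : ∃ t ∈ dyadicSet p l, ∃ a : ℝ, 0 ≤ a ∧
      (ZMod.stdAddChar (v * β) : ℂ).re + a * (ZMod.stdAddChar (t * β) : ℂ).re = 0 := by
    rcases le_or_gt 0 (ZMod.stdAddChar (v * β) : ℂ).re with h | h
    · obtain ⟨j, hj, hneg⟩ := exists_re_stdAddChar_neg hβ hpl
      refine ⟨_, two_pow_mem_dyadicSet hj, _, div_nonneg h (neg_pos.2 hneg).le, ?_⟩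
      rw [div_neg, neg_mul, div_mul_cancel₀ _ hneg.ne, add_neg_cancel]
    · obtain ⟨t, ht, hpos⟩ := exists_re_stdAddChar_pos β hl
      refine ⟨t, ht, _, div_nonneg (neg_pos.2 h).le hpos.le, ?_⟩
      rw [div_mul_cancel₀ _ hpos.ne', add_neg_cancel]
  obtain ⟨t, ht, a, ha, hsum⟩ := key
  refine ⟨fun r => (if r = v then 1 else 0) + (if r = -v then 1 else 0) +
    ((if r = t then a else 0) + (if r = -t then a else 0)), fun r => ?_, ?_, fun r hr => ?_, ?_⟩
  · positivity
  · simp only [if_true]; positivity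
  · by_contra! hcon
    have h1 : r ≠ -v := by
      rintro rfl
      rcases hv with rfl | hv
      · simp at hcon
      · exact hcon.2 (neg_mem_dyadicSet hv)
    have h2 : r ≠ t := by rintro rfl; exact hcon.2 ht
    have h3 : r ≠ -t := by rintro rfl; exact hcon.2 (neg_mem_dyadicSet ht)
    simp [hcon.1, h1, h2, h3] at hr
  · have h1 := stdAddChar_add_neg (v * β)
    have h2 := stdAddChar_add_neg (t * β)
    have h3 : ((2 * (ZMod.stdAddChar (v * β) : ℂ).re : ℝ) : ℂ) +
        a * ((2 * (ZMod.stdAddChar (t * β) : ℂ).re : ℝ) : ℂ) = 0 := by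
      have : (2 * (ZMod.stdAddChar (v * β) : ℂ).re : ℝ) +
        a * ((2 * (ZMod.stdAddChar (t * β) : ℂ).re : ℝ)) = 0 := by linarith
      exact_mod_cast this
    rw [← h3, ← h1, ← h2]
    push_cast
    simp only [add_mul, sum_add_distrib, ite_mul, one_mul, zero_mul, sum_ite_eq', mem_univ, if_true,
      apply_ite (Complex.ofReal), Complex.ofReal_zero, Complex.ofReal_one, neg_mul]
    ring

end Dyadic

lemma addChar_sum_eq_prod {G R κ : Type*} [AddCommMonoid G] [CommMonoid R] (ψ : AddChar G R)
    (s : Finset κ) (f : κ → G) : ψ (∑ i ∈ s, f i) = ∏ i ∈ s, ψ (f i) := by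
  classical
  induction s using Finset.induction_on with
  | empty => simp
  | insert i s hi ih => rw [sum_insert hi, prod_insert hi, AddChar.map_add_eq_mul, ih]

section Cover

variable {p : ℕ} [Fact p.Prime] {n : ℕ} {ι : Type*} [Fintype ι] [DecidableEq ι]

lemma sum_stdAddChar_dotProduct (z : Fin n → ZMod p) :
    ∑ y : Fin n → ZMod p, (ZMod.stdAddChar (z ⬝ᵥ y) : ℂ) = if z = 0 then (p : ℂ) ^ n else 0 := by
  have h1 : ∑ y : Fin n → ZMod p, (ZMod.stdAddChar (z ⬝ᵥ y) : ℂ) =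
      ∏ i, ∑ r : ZMod p, (ZMod.stdAddChar (r * z i) : ℂ) := by
    rw [Finset.prod_univ_sum, Fintype.piFinset_univ]
    refine sum_congr rfl fun y _ => ?_
    rw [dotProduct, addChar_sum_eq_prod]
    simp only [mul_comm]
  have h2 (r : ZMod p) :
      ∑ t : ZMod p, (ZMod.stdAddChar (t * r) : ℂ) = if r = 0 then (p : ℂ) else 0 := by
    rw [AddChar.sum_mulShift r (ZMod.isPrimitive_stdAddChar p)]
    simp
  rw [h1]
  simp only [h2]
  split_ifs with hz
  · simp [hz]
  · obtain ⟨i, hi⟩ := Function.ne_iff.1 hz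
    exact prod_eq_zero (mem_univ i) (if_neg hi)

lemma sum_prod_sum_stdAddChar (c : ι → ZMod p → ℝ) (u : ι → Fin n → ZMod p)
    (z : Fin n → ZMod p) :
    ∑ y : Fin n → ZMod p, (∏ a, ∑ t, (c a t : ℂ) * ZMod.stdAddChar (t * (u a ⬝ᵥ y))) *
        ZMod.stdAddChar (z ⬝ᵥ y) =
      ((p ^ n * ∑ τ : ι → ZMod p, if ∑ a, τ a • u a + z = 0 then ∏ a, c a (τ a) else 0 : ℝ) : ℂ) := by
  have h1 (y : Fin n → ZMod p) :
      (∏ a, ∑ t, (c a t : ℂ) * ZMod.stdAddChar (t * (u a ⬝ᵥ y))) * ZMod.stdAddChar (z ⬝ᵥ y) =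
      ∑ τ : ι → ZMod p, (∏ a, (c a (τ a) : ℂ)) *
        ZMod.stdAddChar ((∑ a, τ a • u a + z) ⬝ᵥ y) := by
    rw [Finset.prod_univ_sum, Fintype.piFinset_univ, sum_mul]
    refine sum_congr rfl fun τ _ => ?_
    rw [prod_mul_distrib, mul_assoc, add_dotProduct, AddChar.map_add_eq_mul, sum_dotProduct,
      addChar_sum_eq_prod]
    simp only [smul_dotProduct, smul_eq_mul]
  simp only [h1]
  rw [sum_comm]
  simp only [← mul_sum, sum_stdAddChar_dotProduct]
  push_cast
  rw [mul_sum]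
  refine sum_congr rfl fun τ _ => ?_
  split_ifs
  · push_cast; ring
  · simp

lemma exists_relation_of_vanishing {c : ι → ZMod p → ℝ} (hc : ∀ a t, 0 ≤ c a t)
    {u : ι → Fin n → ZMod p} {z : Fin n → ZMod p}
    (hz : ∀ y, (∏ a, ∑ t, (c a t : ℂ) * ZMod.stdAddChar (t * (u a ⬝ᵥ y))) ≠ 0 → z ⬝ᵥ y = 0)
    {w : ι → ZMod p} (hw : ∀ a, 0 < c a (w a)) (hw0 : ∑ a, w a • u a = 0) :
    ∃ τ : ι → ZMod p, (∀ a, c a (τ a) ≠ 0) ∧ ∑ a, τ a • u a + z = 0 := by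
  have h1 := sum_prod_sum_stdAddChar c u z
  have h2 := sum_prod_sum_stdAddChar c u 0
  have h3 : ∑ y : Fin n → ZMod p, (∏ a, ∑ t, (c a t : ℂ) * ZMod.stdAddChar (t * (u a ⬝ᵥ y))) *
        ZMod.stdAddChar (z ⬝ᵥ y) = ∑ y : Fin n → ZMod p,
        (∏ a, ∑ t, (c a t : ℂ) * ZMod.stdAddChar (t * (u a ⬝ᵥ y))) *
        ZMod.stdAddChar ((0 : Fin n → ZMod p) ⬝ᵥ y) := by
    refine sum_congr rfl fun y _ => ?_
    by_cases h : (∏ a, ∑ t, (c a t : ℂ) * ZMod.stdAddChar (t * (u a ⬝ᵥ y))) = 0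
    · simp [h]
    · rw [hz y h, zero_dotProduct]
  have hp : (0 : ℝ) < p ^ n := by
    have : 0 < p := (Fact.out : p.Prime).pos
    positivity
  rw [h1, h2] at h3
  have h4 := mul_left_cancel₀ hp.ne' (Complex.ofReal_injective h3)
  have h5 : 0 < ∑ τ : ι → ZMod p, if ∑ a, τ a • u a + 0 = 0 then ∏ a, c a (τ a) else 0 := by
    refine sum_pos' (fun τ _ => ?_) ⟨w, mem_univ _, ?_⟩
    · split_ifs
      exacts [prod_nonneg fun a _ => hc a _, le_rfl]
    · rw [if_pos (by simpa using hw0)]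
      exact prod_pos fun a _ => hw a
  rw [← h4] at h5
  obtain ⟨τ, -, hτ⟩ := exists_ne_zero_of_sum_ne_zero h5.ne'
  rw [ite_ne_right_iff, prod_ne_zero_iff] at hτ
  exact ⟨τ, fun a => hτ.2 a (mem_univ a), hτ.1⟩

/-- The affine hyperplanes `u a ⬝ᵥ x = b a`, for `a ∈ A`, cover the whole space, and no
proper subfamily does. -/
structure IsMinimalCover (A : Finset ι) (u : ι → Fin n → ZMod p) (b : ι → ZMod p) : Prop where
  cover : ∀ x, ∃ a ∈ A, u a ⬝ᵥ x = b a
  minimal : ∀ i ∈ A, ∃ x, ∀ a ∈ A, a ≠ i → u a ⬝ᵥ x ≠ b a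

lemma IsMinimalCover.exists_extension {A : Finset ι} {u : ι → Fin n → ZMod p} {b : ι → ZMod p}
    (hA : IsMinimalCover A u b) {T : ι → Finset (ZMod p)} (hT : ∀ a ∈ A, IsUniversal (T a))
    {w : ι → ZMod p} (hwA : ∀ a ∉ A, w a = 0) (hwT : ∀ a ∈ A, w a = 0 ∨ w a ∈ T a)
    (hw : ∑ a, w a • u a = 0) {i : ι} (hi : i ∈ A) (hwi : w i = 0) (s : ZMod p) :
    ∃ w' : ι → ZMod p, (∀ a ∉ A, w' a = 0) ∧ w' i = s ∧
      (∀ a ∈ A, a ≠ i → w' a = w a ∨ w' a ∈ T a) ∧ ∑ a, w' a • u a = 0 := by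
  obtain ⟨x, hx⟩ := hA.minimal i hi
  have hxi : u i ⬝ᵥ x = b i := by
    obtain ⟨a, ha, h⟩ := hA.cover x
    by_cases hai : a = i
    · rwa [← hai]
    · exact absurd h (hx a ha hai)
  have hc : ∀ a, ∃ c : ZMod p → ℝ, (∀ t, 0 ≤ c t) ∧ 0 < c (w a) ∧
      (a ∈ A ∧ a ≠ i → (∀ t, c t ≠ 0 → t = w a ∨ t ∈ T a) ∧
        ∑ t, (c t : ℂ) * ZMod.stdAddChar (t * (b a - u a ⬝ᵥ x)) = 0) ∧
      (¬ (a ∈ A ∧ a ≠ i) → ∀ t, c t ≠ 0 → t = 0) := by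
    intro a
    by_cases ha : a ∈ A ∧ a ≠ i
    · obtain ⟨c, h0, h1, h2, h3⟩ := (hT a ha.1).2 (b a - u a ⬝ᵥ x)
        (sub_ne_zero.2 (hx a ha.1 ha.2).symm) (w a) (hwT a ha.1)
      exact ⟨c, h0, h1, fun _ => ⟨h2, h3⟩, fun h => absurd ha h⟩
    · have hwa : w a = 0 := by
        by_cases h : a ∈ A
        · rwa [show a = i by by_contra h'; exact ha ⟨h, h'⟩]
        · exact hwA a h
      refine ⟨fun t => if t = 0 then 1 else 0, fun t => by positivity, by simp [hwa],
        fun h => absurd h ha, fun _ t ht => by simpa using ht⟩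
  choose c hc0 hcw hcA hcA' using hc
  obtain ⟨τ, hτ, hsum⟩ := exists_relation_of_vanishing (z := s • u i) hc0 (fun y hy => by
    rw [smul_dotProduct]
    obtain ⟨a, ha, h⟩ := hA.cover (x + y)
    rw [dotProduct_add] at h
    by_cases hai : a = i
    · subst hai
      rw [hxi] at h
      simp [add_eq_left.1 h]
    · refine absurd (prod_eq_zero (mem_univ a) ?_) hy
      rw [← (hcA a ⟨ha, hai⟩).2, ← h, add_sub_cancel_left]) hcw hw
  refine ⟨τ + Pi.single i s, fun a ha => ?_, ?_, fun a ha hai => ?_, ?_⟩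
  · have hai : a ≠ i := by rintro rfl; exact ha hi
    simp [hai, hcA' a (by tauto) _ (hτ a)]
  · simp [hcA' i (by tauto) _ (hτ i)]
  · simpa [hai] using (hcA a ⟨ha, hai⟩).1 _ (hτ a)
  · simpa [add_smul, sum_add_distrib, Pi.single_apply, ite_smul] using hsum

lemma IsMinimalCover.exists_relation {A : Finset ι} {u : ι → Fin n → ZMod p} {b : ι → ZMod p}
    (hA : IsMinimalCover A u b) {T : ι → Finset (ZMod p)} (hT : ∀ a ∈ A, IsUniversal (T a))
    (hne : ∀ a ∈ A, (T a).Nonempty) :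
    ∃ w : ι → ZMod p, (∀ a ∉ A, w a = 0) ∧ (∀ a ∈ A, w a ∈ T a) ∧ ∑ a, w a • u a = 0 := by
  have key : ∀ D ⊆ A, ∃ w : ι → ZMod p, (∀ a ∉ A, w a = 0) ∧ (∀ a ∈ A, w a = 0 ∨ w a ∈ T a) ∧
      (∀ a ∈ D, w a ≠ 0) ∧ ∑ a, w a • u a = 0 := by
    intro D
    induction D using Finset.induction_on with
    | empty => exact fun _ => ⟨0, by simp⟩
    | insert i D hiD ih =>
      intro hD
      obtain ⟨w, h1, h2, h3, h4⟩ := ih ((subset_insert _ _).trans hD)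
      have hi := hD (mem_insert_self i D)
      by_cases hwi : w i = 0
      · obtain ⟨s, hs⟩ := hne i hi
        obtain ⟨w', h1', h2', h3', h4'⟩ := hA.exists_extension hT h1 h2 h4 hi hwi s
        refine ⟨w', h1', fun a ha => ?_, fun a ha => ?_, h4'⟩
        · by_cases hai : a = i
          · subst hai; right; rwa [h2']
          · rcases h3' a ha hai with h | h
            · rw [h]; exact h2 a ha
            · exact Or.inr h
        · by_cases hai : a = i
          · subst hai; rw [h2']; rintro rfl; exact (hT a hi).1 hs
          · have haD := mem_of_mem_insert_of_ne ha hai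
            rcases h3' a (hD ha) hai with h | h
            · rw [h]; exact h3 a haD
            · intro h0; rw [h0] at h; exact (hT a (hD ha)).1 h
      · refine ⟨w, h1, h2, fun a ha => ?_, h4⟩
        rcases mem_insert.1 ha with rfl | ha
        exacts [hwi, h3 a ha]
  obtain ⟨w, h1, h2, h3, h4⟩ := key A Subset.rfl
  exact ⟨w, h1, fun a ha => (h2 a ha).resolve_left (h3 a ha), h4⟩

lemma exists_isMinimalCover {A₀ : Finset ι} {u : ι → Fin n → ZMod p} {b : ι → ZMod p}
    (h : ∀ x, ∃ a ∈ A₀, u a ⬝ᵥ x = b a) : ∃ A ⊆ A₀, IsMinimalCover A u b := by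
  obtain ⟨A, hA, hmin⟩ := (A₀.powerset.filter
    fun A => ∀ x, ∃ a ∈ A, u a ⬝ᵥ x = b a).exists_min_image card
      ⟨A₀, mem_filter.2 ⟨mem_powerset_self _, h⟩⟩
  rw [mem_filter, mem_powerset] at hA
  refine ⟨A, hA.1, hA.2, fun i hi => ?_⟩
  by_contra! hcon
  have := hmin (A.erase i) (mem_filter.2
    ⟨mem_powerset.2 ((erase_subset _ _).trans hA.1), fun x => by
    obtain ⟨a, ha, hai, h⟩ := hcon x
    exact ⟨a, mem_erase.2 ⟨hai, ha⟩, h⟩⟩)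
  have := card_erase_lt_of_mem hi
  omega

lemma IsMinimalCover.card_pow_le {A R : Finset ι} {u : ι → Fin n → ZMod p} {b : ι → ZMod p}
    (hA : IsMinimalCover A u b) (hR : R ⊆ A) (φ : ι → (Fin n → ZMod p) →ₗ[ZMod p] ZMod p)
    (hφ : ∀ a ∈ R, ∀ a' ∈ R, φ a (u a') = if a' = a then 1 else 0)
    {T : Finset (ZMod p)} (hT : IsUniversal T) (hne : T.Nonempty) :
    (p - 1) ^ R.card ≤ T.card ^ A.card := by
  let Λ : Finset (ι → ZMod p) := Fintype.piFinset fun a => if a ∈ R then univ.erase 0 else {1}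
  let Q : Finset (ι → ZMod p) := Fintype.piFinset fun a => if a ∈ A then T else {0}
  have hΛ : Λ.card = (p - 1) ^ R.card := by
    have h (a : ι) : (if a ∈ R then univ.erase 0 else {1} : Finset (ZMod p)).card =
        if a ∈ R then p - 1 else 1 := by
      split_ifs <;> simp [card_erase_of_mem, ZMod.card]
    simp only [Λ, Fintype.card_piFinset, h, prod_ite_mem, univ_inter, prod_const]
  have hQ : Q.card = T.card ^ A.card := by
    have h (a : ι) : (if a ∈ A then T else {0} : Finset (ZMod p)).card =
        if a ∈ A then T.card else 1 := by
      split_ifs <;> simp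
    simp only [Q, Fintype.card_piFinset, h, prod_ite_mem, univ_inter, prod_const]
  have hΛ0 {r : ι → ZMod p} (hr : r ∈ Λ) (a : ι) : r a ≠ 0 := by
    have := Fintype.mem_piFinset.1 hr a
    split_ifs at this
    · exact (mem_erase.1 this).1
    · rw [mem_singleton.1 this]; exact one_ne_zero
  have hΛ1 {r : ι → ZMod p} (hr : r ∈ Λ) {a : ι} (ha : a ∉ R) : r a = 1 := by
    simpa [ha] using Fintype.mem_piFinset.1 hr a
  have hex (r : ι → ZMod p) : ∃ q : ι → ZMod p, r ∈ Λ →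
      q ∈ Q ∧ ∑ a, (r a * q a) • u a = 0 := by
    by_cases hr : r ∈ Λ
    swap
    · exact ⟨0, fun h => absurd h hr⟩
    obtain ⟨w, h1, h2, h3⟩ := hA.exists_relation (T := fun a => T.image (r a * ·))
      (fun a _ => hT.image_mul (hΛ0 hr a)) (fun a _ => hne.image _)
    refine ⟨fun a => (r a)⁻¹ * w a, fun _ => ⟨Fintype.mem_piFinset.2 fun a => ?_, ?_⟩⟩
    · split_ifs with ha
      · obtain ⟨t, ht, h⟩ := mem_image.1 (h2 a ha)
        rw [← h]
        simpa [hΛ0 hr a] using ht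
      · simp [h1 a ha]
    · simpa [hΛ0 hr] using h3
  choose f hf using hex
  rw [← hΛ, ← hQ]
  refine card_le_card_of_injOn f (fun r hr => (hf r hr).1) fun r hr r' hr' heq => ?_
  have h1 := (hf r hr).2
  have h2 := (hf r' hr').2
  rw [← heq] at h2
  have h3 : ∑ a, ((r a - r' a) * f r a) • u a = 0 := by
    rw [← sub_eq_zero.2 (h1.trans h2.symm), ← sum_sub_distrib]
    simp only [sub_mul, sub_smul]
  funext a
  by_cases ha : a ∈ R
  · have h4 := congrArg (φ a) h3
    rw [map_sum, map_zero, sum_eq_single_of_mem a (mem_univ a)] at h4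
    · have h5 : f r a ≠ 0 := by
        have := Fintype.mem_piFinset.1 (hf r hr).1 a
        rw [if_pos (hR ha)] at this
        rintro h0
        exact hT.1 (h0 ▸ this)
      rw [map_smul, hφ a ha a ha, if_pos rfl] at h4
      simpa [h5, sub_eq_zero] using h4
    · intro a' _ haa'
      by_cases ha' : a' ∈ R
      · rw [map_smul, hφ a ha a' ha', if_neg haa', smul_zero]
      · rw [hΛ1 hr ha', hΛ1 hr' ha']; simp
  · rw [hΛ1 hr ha, hΛ1 hr' ha]

end Cover

lemma exists_exponent {k p : ℕ} (hk : 2 ≤ k) (hp : k ^ (64 * k) < p) :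
    ∃ l, 2 ≤ l ∧ p ^ 2 ≤ 2 ^ l ∧ (2 * (l + 2)) ^ (2 * k) < p - 1 := by
  have hp0 : p ≠ 0 := by omega
  set κ := Nat.log 2 k with hκ
  set L := Nat.log 2 p with hL
  have hκ1 : 1 ≤ κ := Nat.le_log_of_pow_le (by norm_num) (by simpa using hk)
  have hkκ : k < 2 ^ (κ + 1) := Nat.lt_pow_succ_log_self (by norm_num) k
  have hκk : 2 ^ κ ≤ k := Nat.pow_log_le_self 2 (by omega)
  have hpL : p < 2 ^ (L + 1) := Nat.lt_pow_succ_log_self (by norm_num) p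
  have hLp : 2 ^ L ≤ p := Nat.pow_log_le_self 2 hp0
  have hκL : κ * (64 * k) ≤ L := by
    refine Nat.le_log_of_pow_le (by norm_num) ?_
    rw [pow_mul]
    exact (Nat.pow_le_pow_left hκk _).trans hp.le
  set q := L / (2 * k) with hq
  have hqκ : 32 * κ ≤ q := by
    rw [hq, Nat.le_div_iff_mul_le (by omega)]
    calc 32 * κ * (2 * k) = κ * (64 * k) := by ring
      _ ≤ L := hκL
  have hLq : L < 2 * k * (q + 1) := Nat.lt_mul_div_succ L (by omega)
  have hqL : 2 * k * q ≤ L := Nat.mul_div_le L (2 * k)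
  have hm : ∀ m : ℕ, 16 ≤ m → 2 * m + 2 ≤ 2 ^ m := by
    intro m hm
    induction m, hm using Nat.le_induction with
    | base => norm_num
    | succ m _ ih => rw [pow_succ]; omega
  have hbound : (q + 1) * 2 ^ (κ + 6) ≤ 2 ^ q :=
    calc (q + 1) * 2 ^ (κ + 6) ≤ 2 ^ (q / 2) * 2 ^ (q / 2) := by
          refine Nat.mul_le_mul ?_ (Nat.pow_le_pow_right (by norm_num) (by omega))
          have := hm (q / 2) (by omega)
          omega
      _ = 2 ^ (q / 2 + q / 2) := (pow_add _ _ _).symm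
      _ ≤ 2 ^ q := Nat.pow_le_pow_right (by norm_num) (by omega)
  obtain ⟨r, hr⟩ : ∃ r, q = r + 1 := ⟨q - 1, by omega⟩
  have hbase : 2 * (2 * (L + 1) + 2) ≤ 2 ^ r := by
    have h1 : k * (q + 1) ≤ 2 ^ (κ + 1) * (q + 1) := Nat.mul_le_mul_right _ hkκ.le
    have h2 : (q + 1) * 2 ^ (κ + 6) = 32 * (2 ^ (κ + 1) * (q + 1)) := by ring
    have h3 : 2 ^ q = 2 * 2 ^ r := by rw [hr]; ring
    have h4 : 1 * 1 ≤ k * (q + 1) := Nat.mul_le_mul (by omega) (by omega)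
    have h5 : 2 * k * (q + 1) = 2 * (k * (q + 1)) := by ring
    omega
  refine ⟨2 * (L + 1), by omega, ?_, ?_⟩
  · rw [mul_comm 2, pow_mul]
    exact Nat.pow_le_pow_left hpL.le 2
  · have h1 : (2 * (2 * (L + 1) + 2)) ^ (2 * k) ≤ 2 ^ (2 * k * r) := by
      rw [mul_comm (2 * k) r, pow_mul 2 r]
      exact Nat.pow_le_pow_left hbase _
    have h2 : 2 ^ (2 * k * r) * 2 ^ 4 ≤ p := by
      rw [← pow_add]
      refine (Nat.pow_le_pow_right (by norm_num) ?_).trans hLp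
      rw [hr] at hqL
      nlinarith
    have h3 : 0 < 2 ^ (2 * k * r) := by positivity
    omega

/-- The standard basis vectors followed by the rows of `M`. -/
def basisAndRows {p n : ℕ} (M : Matrix (Fin n) (Fin n) (ZMod p)) :
    Fin n ⊕ Fin n → Fin n → ZMod p :=
  Sum.elim (fun i => Pi.single i 1) M

lemma basisAndRows_inl {p n : ℕ} (M : Matrix (Fin n) (Fin n) (ZMod p)) (i : Fin n) :
    basisAndRows M (Sum.inl i) = Pi.single i 1 := rfl

lemma basisAndRows_inr {p n : ℕ} (M : Matrix (Fin n) (Fin n) (ZMod p)) (i : Fin n) :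
    basisAndRows M (Sum.inr i) = M i := rfl

/-- The coordinate functionals dual to the two bases listed in `basisAndRows M`. -/
noncomputable def dualBasisAndRows {p n : ℕ} (M : Matrix (Fin n) (Fin n) (ZMod p)) :
    Fin n ⊕ Fin n → (Fin n → ZMod p) →ₗ[ZMod p] ZMod p :=
  Sum.elim (fun i => LinearMap.proj i) (fun i => LinearMap.proj i ∘ₗ (M⁻¹).vecMulLinear)

lemma dualBasisAndRows_basisAndRows {p n : ℕ} {M : Matrix (Fin n) (Fin n) (ZMod p)}
    (hM : IsUnit M.det) {c c' : Fin n ⊕ Fin n} (h : c.isLeft = c'.isLeft) :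
    dualBasisAndRows M c (basisAndRows M c') = if c' = c then 1 else 0 := by
  rcases c with i | i <;> rcases c' with j | j
  · simp [dualBasisAndRows, basisAndRows_inl, Pi.single_apply, eq_comm]
  · simp at h
  · simp at h
  · have : (M * M⁻¹) j i = (Matrix.vecMul (M j) M⁻¹) i := rfl
    simp [dualBasisAndRows, basisAndRows_inr, ← this, Matrix.mul_nonsing_inv M hM,
      Matrix.one_apply]

lemma exists_mem_of_card_pow_lt {p n k : ℕ} [Fact p.Prime] {T : Finset (ZMod p)}
    (hT : IsUniversal T) (hne : T.Nonempty) (hcard : T.card ^ (2 * k) < p - 1)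
    {M : Matrix (Fin n) (Fin n) (ZMod p)} (hM : IsUnit M.det) {Z : Fin n ⊕ Fin n → Finset (ZMod p)}
    (hZ : ∀ c, p - k ≤ (Z c).card) :
    ∃ x : Fin n → ZMod p, ∀ c, basisAndRows M c ⬝ᵥ x ∈ Z c := by
  by_contra! hcon
  obtain ⟨A, hA₀, hA⟩ := exists_isMinimalCover
    (A₀ := univ.filter fun a : (Fin n ⊕ Fin n) × ZMod p => a.2 ∉ Z a.1)
    (u := fun a => basisAndRows M a.1) (b := Prod.snd) (fun x => by
      obtain ⟨c, hc⟩ := hcon x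
      exact ⟨(c, _), by simpa using hc, rfl⟩)
  have hfiber (c : Fin n ⊕ Fin n) : (A.filter fun a => a.1 = c).card ≤ k := by
    have h1 : (A.filter fun a => a.1 = c) ⊆ (Z c)ᶜ.image (Prod.mk c) := by
      intro a ha
      rw [mem_filter] at ha
      have := (mem_filter.1 (hA₀ ha.1)).2
      rw [ha.2] at this
      exact mem_image.2 ⟨a.2, mem_compl.2 this, by rw [← ha.2]⟩
    have h2 := (card_le_card h1).trans card_image_le
    rw [card_compl, ZMod.card] at h2
    have := hZ c
    omega
  obtain ⟨s, hs⟩ : ∃ s : Bool, A.card ≤ 2 * (A.filter fun a => a.1.isLeft = s).card := by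
    have := card_filter_add_card_filter_not (s := A) (fun a => a.1.isLeft = true)
    by_contra! h
    have h1 := h true
    have h2 := h false
    simp only [Bool.not_eq_true] at this
    omega
  set B := A.filter fun a => a.1.isLeft = s with hB
  have hApos : 0 < A.card := by
    obtain ⟨a, ha, -⟩ := hA.cover 0
    exact card_pos.2 ⟨a, ha⟩
  set J := B.image Prod.fst with hJ
  have hBJ : B.card ≤ k * J.card := card_le_mul_card_image B k fun c _ =>
    (card_le_card (filter_subset_filter _ (filter_subset _ _))).trans (hfiber c)
  have hrep : ∀ c, ∃ a : (Fin n ⊕ Fin n) × ZMod p, c ∈ J → a ∈ B ∧ a.1 = c := by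
    intro c
    by_cases hc : c ∈ J
    · obtain ⟨a, ha, h⟩ := mem_image.1 hc
      exact ⟨a, fun _ => ⟨ha, h⟩⟩
    · exact ⟨(c, 0), fun h => absurd h hc⟩
  choose r hr using hrep
  have hRJ : (J.image r).card = J.card := card_image_of_injOn fun c hc c' hc' h => by
    rw [← (hr c hc).2, ← (hr c' hc').2, h]
  have hRA : J.image r ⊆ A := fun a ha => by
    obtain ⟨c, hc, rfl⟩ := mem_image.1 ha
    exact (mem_filter.1 (hr c hc).1).1
  have key := hA.card_pow_le hRA (fun a => dualBasisAndRows M a.1) (by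
    intro a ha a' ha'
    obtain ⟨c, hc, rfl⟩ := mem_image.1 ha
    obtain ⟨c', hc', rfl⟩ := mem_image.1 ha'
    rw [dualBasisAndRows_basisAndRows hM
      ((mem_filter.1 (hr c hc).1).2.trans (mem_filter.1 (hr c' hc').1).2.symm),
      (hr c hc).2, (hr c' hc').2]
    by_cases h : c' = c
    · simp [h]
    · have : r c' ≠ r c := fun h' => h (by rw [← (hr c hc).2, ← (hr c' hc').2, h'])
      simp [h, this]) hT hne
  rw [hRJ] at key
  have hJpos : J.card ≠ 0 := by
    intro h
    rw [h] at hBJ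
    omega
  have h1 : T.card ^ A.card ≤ (T.card ^ (2 * k)) ^ J.card := by
    rw [← pow_mul]
    refine Nat.pow_le_pow_right hne.card_pos ?_
    calc A.card ≤ 2 * B.card := hs
      _ ≤ 2 * (k * J.card) := by omega
      _ = 2 * k * J.card := by ring
  exact absurd (key.trans h1) (not_le.2 (Nat.pow_lt_pow_left hcard hJpos))

/-- **Theorem B.** There exists a universal constant `K ≥ 32` such that for every `k ≥ 2`,
every prime `p > k^(K*k)`, every `n ≥ 1`, every nonsingular `n × n` matrix `M` over `F_p`
and all subsets `X i, Y i ⊆ F_p` of size at least `p - k`, there is `x` with `x i ∈ X i`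
and `(M x) i ∈ Y i` for every `i`. -/
theorem stmt_1 :
    ∃ K : ℕ, 32 ≤ K ∧
      ∀ k : ℕ, 2 ≤ k →
      ∀ p : ℕ, p.Prime → k ^ (K * k) < p →
      ∀ n : ℕ, 1 ≤ n →
      ∀ M : Matrix (Fin n) (Fin n) (ZMod p), IsUnit M.det →
      ∀ X Y : Fin n → Finset (ZMod p),
        (∀ i, p - k ≤ (X i).card) → (∀ i, p - k ≤ (Y i).card) →
        ∃ x : Fin n → ZMod p, (∀ i, x i ∈ X i) ∧ (∀ i, M.mulVec x i ∈ Y i) := by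
  refine ⟨64, by norm_num, fun k hk p hp hkp n _ M hM X Y hX hY => ?_⟩
  have : Fact p.Prime := ⟨hp⟩
  obtain ⟨l, hl, hpl, hlt⟩ := exists_exponent hk hkp
  have hp3 : 3 < p := by
    have h1 : 1 ≤ (2 * (l + 2)) ^ (2 * k) := Nat.one_le_pow _ _ (by omega)
    have h2 : 2 * (l + 2) ≤ (2 * (l + 2)) ^ (2 * k) := Nat.le_self_pow (by omega) _
    omega
  obtain ⟨x, hx⟩ := exists_mem_of_card_pow_lt (isUniversal_dyadicSet hp3 hl hpl)
    ⟨_, two_pow_mem_dyadicSet (Nat.zero_le l)⟩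
    ((Nat.pow_le_pow_left (card_dyadicSet_le l) _).trans_lt hlt) hM
    (Z := Sum.elim X Y) (by rintro (i | i); exacts [hX i, hY i])
  refine ⟨x, fun i => ?_, fun i => hx (Sum.inr i)⟩
  simpa [basisAndRows_inl] using hx (Sum.inl i)
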